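/- arXiv:2401.05243 — 3 statements merged into one kernel-verified Lean document; each statement's English description precedes it below -/
import Mathlib

section
/- Let H be a Hilbert space and let (g_n) be a Bessel sequence in H with Bessel bound B > 0. If (g_n) is dextrodual to a sequence (x_n) in H, then (x_n) is a semi-lower frame with lower bound at least 1/B, i.e. (1/B)‖f‖² ≤ Σ_n |⟨f, x_n⟩|² for all f ∈ H. -/
open MeasureTheory Filter Complex Real ENNReal

noncomputable section

local notation "⟪" x ", " y "⟫" => @inner ℂ _ _ x y

/-- `∑' n, |⟨f, g_n⟩|²` computed in `ℝ≥0∞` (`⟨f, g⟩` denotes the inner product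
that is linear in `f`, i.e. Mathlib's `⟪g, f⟫`). -/
def frameSum {H : Type*} [NormedAddCommGroup H] [InnerProductSpace ℂ H]
    {ι : Type*} (g : ι → H) (f : H) : ℝ≥0∞ :=
  ∑' n, (‖⟪g n, f⟫‖₊ : ℝ≥0∞) ^ 2

/-- Bessel sequence with bound `B`. -/
def IsBesselWith {H : Type*} [NormedAddCommGroup H] [InnerProductSpace ℂ H]
    {ι : Type*} (g : ι → H) (B : ℝ) : Prop :=
  ∀ f : H, frameSum g f ≤ ENNReal.ofReal (B * ‖f‖ ^ 2)

/-- Semi-lower frame with bound `A`. -/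
def IsSemiLowerWith {H : Type*} [NormedAddCommGroup H] [InnerProductSpace ℂ H]
    {ι : Type*} (g : ι → H) (A : ℝ) : Prop :=
  ∀ f : H, ENNReal.ofReal (A * ‖f‖ ^ 2) ≤ frameSum g f

/-- Frame: upper and lower frame bounds. -/
def IsFrame {H : Type*} [NormedAddCommGroup H] [InnerProductSpace ℂ H]
    {ι : Type*} (g : ι → H) : Prop :=
  ∃ A B : ℝ, 0 < A ∧ 0 < B ∧ IsSemiLowerWith g A ∧ IsBesselWith g B

/-- Parseval frame. -/
def IsParseval {H : Type*} [NormedAddCommGroup H] [InnerProductSpace ℂ H]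
    {ι : Type*} (g : ι → H) : Prop :=
  ∀ f : H, frameSum g f = ENNReal.ofReal (‖f‖ ^ 2)

/-- Riesz basis: a frame such that `∑ cₙ gₙ = 0` with `(cₙ) ∈ ℓ²` forces `c = 0`. -/
def IsRieszBasis {H : Type*} [NormedAddCommGroup H] [InnerProductSpace ℂ H]
    {ι : Type*} (g : ι → H) : Prop :=
  IsFrame g ∧ ∀ c : ι → ℂ, (Summable fun n => ‖c n‖ ^ 2) →
    HasSum (fun n => c n • g n) 0 → ∀ n, c n = 0

/-- `(g_n)` is dextrodual to `(x'_n)`: every `x` equals `∑ₙ ⟨x, gₙ⟩ x'ₙ`,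
with convergence of the ordered partial sums (ℕ-indexed). -/
def IsDextrodual {H : Type*} [NormedAddCommGroup H] [InnerProductSpace ℂ H]
    (g x' : ℕ → H) : Prop :=
  ∀ x : H, Tendsto (fun N => ∑ n ∈ Finset.range N, ⟪g n, x⟫ • x' n) atTop (nhds x)

/-- `(g_n)` is dextrodual to `(x'_n)`: every `x` equals `∑ₙ ⟨x, gₙ⟩ x'ₙ`,
with convergence of the symmetric partial sums (ℤ-indexed). -/
def IsDextrodualZ {H : Type*} [NormedAddCommGroup H] [InnerProductSpace ℂ H]
    (g x' : ℤ → H) : Prop :=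
  ∀ x : H, Tendsto (fun M : ℕ => ∑ n ∈ Finset.Icc (-(M : ℤ)) (M : ℤ), ⟪g n, x⟫ • x' n)
    atTop (nhds x)

theorem sum_norm_inner_sq_le_of_frameSum_le {H : Type*} [NormedAddCommGroup H]
    [InnerProductSpace ℂ H] {ι : Type*} {g : ι → H} {f : H} {C : ℝ} (hC : 0 ≤ C)
    (h : frameSum g f ≤ ENNReal.ofReal C) (s : Finset ι) :
    ∑ n ∈ s, ‖⟪g n, f⟫‖ ^ 2 ≤ C := by
  rw [← ENNReal.ofReal_le_ofReal_iff hC,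
    ENNReal.ofReal_sum_of_nonneg fun _ _ => sq_nonneg _]
  refine le_trans (le_of_eq ?_) ((ENNReal.sum_le_tsum s).trans h)
  refine Finset.sum_congr rfl fun n _ => ?_
  rw [ENNReal.ofReal_pow (norm_nonneg _), ofReal_norm]
  rfl

/-- If a Bessel sequence `(gₙ)` with bound `B > 0` is dextrodual to `(xₙ)`,
then `(xₙ)` is a semi-lower frame with lower bound at least `1/B`. -/
theorem statement1 {H : Type*} [NormedAddCommGroup H] [InnerProductSpace ℂ H]
    (g x : ℕ → H) (B : ℝ) (hB : 0 < B) (hbessel : IsBesselWith g B)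
    (hdex : IsDextrodual g x) :
    IsSemiLowerWith x (1 / B) := by
  intro f
  by_cases htop : frameSum x f = ⊤
  · simp [htop]
  set S := (frameSum x f).toReal
  have hS : frameSum x f = ENNReal.ofReal S := (ENNReal.ofReal_toReal htop).symm
  have hS0 : 0 ≤ S := ENNReal.toReal_nonneg
  have hlim : Tendsto (fun N => ‖⟪f, ∑ n ∈ Finset.range N, ⟪g n, f⟫ • x n⟫‖ ^ 2) atTop
      (nhds (‖⟪f, f⟫‖ ^ 2)) :=
    ((tendsto_const_nhds.inner (hdex f)).norm).pow 2
  have hbound (N : ℕ) :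
      ‖⟪f, ∑ n ∈ Finset.range N, ⟪g n, f⟫ • x n⟫‖ ^ 2 ≤ B * ‖f‖ ^ 2 * S := by
    have hnorm : ‖⟪f, ∑ n ∈ Finset.range N, ⟪g n, f⟫ • x n⟫‖ ≤
        ∑ n ∈ Finset.range N, ‖⟪g n, f⟫‖ * ‖⟪x n, f⟫‖ := by
      rw [inner_sum]
      refine (norm_sum_le _ _).trans_eq (Finset.sum_congr rfl fun n _ => ?_)
      rw [inner_smul_right, norm_mul, norm_inner_symm f]
    calc _ ≤ (∑ n ∈ Finset.range N, ‖⟪g n, f⟫‖ * ‖⟪x n, f⟫‖) ^ 2 := by gcongr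
      _ ≤ (∑ n ∈ Finset.range N, ‖⟪g n, f⟫‖ ^ 2) * ∑ n ∈ Finset.range N, ‖⟪x n, f⟫‖ ^ 2 :=
        Finset.sum_mul_sq_le_sq_mul_sq _ _ _
      _ ≤ B * ‖f‖ ^ 2 * S := by
        gcongr
        · exact sum_norm_inner_sq_le_of_frameSum_le (by positivity) (hbessel f) _
        · exact sum_norm_inner_sq_le_of_frameSum_le hS0 hS.le _
  have hle : (‖f‖ ^ 2) ^ 2 ≤ B * ‖f‖ ^ 2 * S := by
    simpa [inner_self_eq_norm_sq_to_K] using le_of_tendsto' hlim hbound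
  rw [hS]
  refine ENNReal.ofReal_le_ofReal ?_
  rw [one_div, inv_mul_le_iff₀ hB]
  rcases eq_or_ne f 0 with rfl | hf
  · simpa using mul_nonneg hB.le hS0
  · have hpos : 0 < ‖f‖ ^ 2 := by positivity
    nlinarith

end
end

section
/- Let H be a Hilbert space and let (g_n)_{n≥0} be a frame of H. Let V = {(⟨f, g_n⟩)_{n≥0} : f ∈ H} ⊆ ℓ²(ℕ) be the range of the analysis operator of (g_n), and let L : ℓ²(ℕ) → ℓ²(ℕ) be the left shift L((a_n)_n) = (a_{n+1})_n. Then L(V) ⊆ V if and only if there exists a bounded linear operator T : H → H with T g_n = g_{n+1} for all n ≥ 0. -/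
open MeasureTheory Filter Complex Real ENNReal

noncomputable section

local notation "⟪" x ", " y "⟫" => @inner ℂ _ _ x y

/-- A vector is determined by its coefficients against a sequence with a lower frame bound. -/
lemma IsSemiLowerWith.eq_of_inner_eq {H : Type*} [NormedAddCommGroup H] [InnerProductSpace ℂ H]
    {ι : Type*} {g : ι → H} {A : ℝ} (hA : 0 < A) (hg : IsSemiLowerWith g A) {x y : H}
    (h : ∀ n, ⟪g n, x⟫ = ⟪g n, y⟫) : x = y := by
  have hsum : frameSum g (x - y) = 0 := by simp [frameSum, h]
  have hle := hg (x - y)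
  rw [hsum, nonpos_iff_eq_zero, ENNReal.ofReal_eq_zero] at hle
  have hsq : ‖x - y‖ ^ 2 = 0 :=
    le_antisymm (nonpos_of_mul_nonpos_right hle hA) (sq_nonneg _)
  exact sub_eq_zero.mp (norm_eq_zero.mp (pow_eq_zero_iff two_ne_zero |>.mp hsq))

/-- Let `(gₙ)_{n≥0}` be a frame of a Hilbert space `H`, and let
`V = {(⟨f, gₙ⟩)ₙ : f ∈ H}` be the range of its analysis operator.  Then `V` is invariant
under the left shift if and only if some bounded operator `T : H → H` satisfies
`T gₙ = g_{n+1}` for all `n`. -/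
theorem statement17 {H : Type*} [NormedAddCommGroup H] [InnerProductSpace ℂ H]
    [CompleteSpace H] (g : ℕ → H) (hg : IsFrame g) :
    ((fun s : ℕ → ℂ => fun n => s (n + 1)) ''
        {s : ℕ → ℂ | ∃ f : H, ∀ n, s n = ⟪g n, f⟫} ⊆
      {s : ℕ → ℂ | ∃ f : H, ∀ n, s n = ⟪g n, f⟫}) ↔
    ∃ T : H →L[ℂ] H, ∀ n, T (g n) = g (n + 1) := by
  obtain ⟨A, _, hA, _, hlow, _⟩ := hg
  constructor
  · intro h
    have hex : ∀ f : H, ∃ f' : H, ∀ n, ⟪g n, f'⟫ = ⟪g (n + 1), f⟫ := fun f => by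
      obtain ⟨f', hf'⟩ := h ⟨fun n => ⟪g n, f⟫, ⟨f, fun _ => rfl⟩, rfl⟩
      exact ⟨f', fun n => (hf' n).symm⟩
    choose S hS using hex
    let Slin : H →ₗ[ℂ] H :=
      { toFun := S
        map_add' := fun x y => hlow.eq_of_inner_eq hA fun n => by
          simp only [hS, inner_add_right]
        map_smul' := fun c x => hlow.eq_of_inner_eq hA fun n => by
          simp only [hS, inner_smul_right, RingHom.id_apply] }
    let Sclm : H →L[ℂ] H := ContinuousLinearMap.ofSeqClosedGraph (g := Slin) <| by
      intro u x y hu hSu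
      refine hlow.eq_of_inner_eq hA fun n => ?_
      have hy : Tendsto (fun k => ⟪g n, S (u k)⟫) atTop (nhds ⟪g n, y⟫) :=
        tendsto_const_nhds.inner hSu
      have hx : Tendsto (fun k => ⟪g (n + 1), u k⟫) atTop (nhds ⟪g (n + 1), x⟫) :=
        tendsto_const_nhds.inner hu
      simp only [hS] at hy
      exact (tendsto_nhds_unique hy hx).trans (hS x n).symm
    refine ⟨ContinuousLinearMap.adjoint Sclm, fun n => ext_inner_right ℂ fun f => ?_⟩
    rw [ContinuousLinearMap.adjoint_inner_left]
    exact hS f n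
  · rintro ⟨T, hT⟩ _ ⟨s, ⟨f, hf⟩, rfl⟩
    refine ⟨ContinuousLinearMap.adjoint T f, fun n => ?_⟩
    rw [ContinuousLinearMap.adjoint_inner_right, hT]
    exact hf (n + 1)

end
end

section
/- Let H be a separable Hilbert space and let (g_n) be a Riesz basis of H that is dextrodual to a sequence (x_n) in H. Then for every (c_n) ∈ ℓ², the series Σ_n c_n x_n converges in H; the resulting synthesis operator ℓ² → H, (c_n) ↦ Σ_n c_n x_n, is bounded; and every f ∈ H satisfies f = Σ_n ⟨f, x_n⟩ g_n with convergence in the norm of H. -/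
open MeasureTheory Filter Complex Real ENNReal

noncomputable section

local notation "⟪" x ", " y "⟫" => @inner ℂ _ _ x y

section AnalysisOperator

variable {H : Type*} [NormedAddCommGroup H] [InnerProductSpace ℂ H] {ι : Type*} {g : ι → H}

theorem frameSum_eq_tsum_ofReal (g : ι → H) (f : H) :
    frameSum g f = ∑' n, ENNReal.ofReal (‖⟪g n, f⟫‖ ^ 2) := by
  refine tsum_congr fun n => ?_
  rw [ENNReal.ofReal_pow (norm_nonneg _), ofReal_norm]
  rfl

theorem IsBesselWith.summable {B : ℝ} (hg : IsBesselWith g B) (f : H) :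
    Summable fun n => ‖⟪g n, f⟫‖ ^ 2 := by
  have h : ∑' n, ENNReal.ofReal (‖⟪g n, f⟫‖ ^ 2) ≠ ∞ := by
    rw [← frameSum_eq_tsum_ofReal]
    exact ne_top_of_le_ne_top ENNReal.ofReal_ne_top (hg f)
  refine (ENNReal.summable_toReal h).congr fun n => ?_
  exact ENNReal.toReal_ofReal (by positivity)

theorem IsBesselWith.frameSum_eq_ofReal {B : ℝ} (hg : IsBesselWith g B) (f : H) :
    frameSum g f = ENNReal.ofReal (∑' n, ‖⟪g n, f⟫‖ ^ 2) := by
  rw [frameSum_eq_tsum_ofReal,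
    ENNReal.ofReal_tsum_of_nonneg (fun n => by positivity) (hg.summable f)]

theorem memℓp_two_of_summable {c : ι → ℂ} (hc : Summable fun n => ‖c n‖ ^ 2) : Memℓp c 2 :=
  memℓp_gen (by simpa using hc)

theorem lp_two_norm_sq (c : lp (fun _ : ι => ℂ) 2) : ‖c‖ ^ 2 = ∑' n, ‖c n‖ ^ 2 := by
  simpa using lp.norm_rpow_eq_tsum (by simp) c

/-- The analysis operator `f ↦ (⟨f, gₙ⟩)ₙ` of a Bessel sequence. -/
def IsBesselWith.analysis {B : ℝ} (hg : IsBesselWith g B) (hB : 0 ≤ B) :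
    H →L[ℂ] lp (fun _ : ι => ℂ) 2 :=
  LinearMap.mkContinuous
    { toFun := fun f => ⟨fun n => ⟪g n, f⟫, memℓp_two_of_summable (hg.summable f)⟩
      map_add' := fun f f' => lp.ext (funext fun n => inner_add_right _ _ _)
      map_smul' := fun a f => lp.ext (funext fun n => inner_smul_right _ _ _) }
    (√B) fun f => by
      refine le_of_sq_le_sq ?_ (by positivity)
      rw [lp_two_norm_sq, mul_pow, Real.sq_sqrt hB]
      have h := hg f
      rw [hg.frameSum_eq_ofReal] at h
      exact (ENNReal.ofReal_le_ofReal_iff (by positivity)).1 h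

@[simp]
theorem IsBesselWith.analysis_apply {B : ℝ} (hg : IsBesselWith g B) (hB : 0 ≤ B) (f : H) (n : ι) :
    hg.analysis hB f n = ⟪g n, f⟫ := rfl

theorem IsBesselWith.le_norm_analysis_sq {A B : ℝ} (hg : IsBesselWith g B) (hB : 0 ≤ B)
    (hA : IsSemiLowerWith g A) (f : H) : A * ‖f‖ ^ 2 ≤ ‖hg.analysis hB f‖ ^ 2 := by
  have h := hA f
  rw [hg.frameSum_eq_ofReal] at h
  rw [lp_two_norm_sq]
  exact (ENNReal.ofReal_le_ofReal_iff (tsum_nonneg fun n => by positivity)).1 h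

variable [CompleteSpace H]

theorem IsBesselWith.hasSum_adjoint_analysis {B : ℝ} (hg : IsBesselWith g B) (hB : 0 ≤ B)
    (c : lp (fun _ : ι => ℂ) 2) :
    HasSum (fun n => c n • g n) ((hg.analysis hB).adjoint c) := by
  classical
  refine ((lp.hasSum_single (by simp) c).mapL (hg.analysis hB).adjoint).congr_fun fun n => ?_
  refine ext_inner_right ℂ fun f => ?_
  rw [ContinuousLinearMap.adjoint_inner_left, lp.inner_single_left, inner_smul_left,
    IsBesselWith.analysis_apply, RCLike.inner_apply, mul_comm]

/-- The analysis operator of a Riesz basis is an isomorphism onto `ℓ²`. -/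
theorem IsRieszBasis.exists_analysis_equiv (hg : IsRieszBasis g) :
    ∃ (A : ℝ) (T : H ≃L[ℂ] lp (fun _ : ι => ℂ) 2), 0 < A ∧ (∀ f n, T f n = ⟪g n, f⟫) ∧
      (∀ f, A * ‖f‖ ^ 2 ≤ ‖T f‖ ^ 2) ∧
      ∀ c, HasSum (fun n => c n • g n) ((T : H →L[ℂ] lp (fun _ : ι => ℂ) 2).adjoint c) := by
  obtain ⟨⟨A, B, hA, hB, hlow, hup⟩, hinj⟩ := hg
  let T := hup.analysis hB.le
  have hle := hup.le_norm_analysis_sq hB.le hlow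
  have hanti : AntilipschitzWith (Real.toNNReal (√A)⁻¹) T := by
    refine T.antilipschitz_of_bound fun f => ?_
    rw [Real.coe_toNNReal _ (by positivity), inv_mul_eq_div, le_div_iff₀ (by positivity)]
    refine le_of_sq_le_sq ?_ (norm_nonneg _)
    rw [mul_pow, Real.sq_sqrt hA.le, mul_comm]
    exact hle f
  have hclosed : IsClosed (T.range : Set (lp (fun _ : ι => ℂ) 2)) := by
    rw [LinearMap.coe_range]
    exact hanti.isClosed_range T.uniformContinuous
  have hrange : T.range = ⊤ := by
    rw [← hclosed.submodule_topologicalClosure_eq, Submodule.topologicalClosure_eq_top_iff,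
      T.orthogonal_range, Submodule.eq_bot_iff]
    intro c hc
    refine lp.ext (funext (hinj c ?_ ?_))
    · simpa using (lp.memℓp c).summable (by simp)
    · have h := hup.hasSum_adjoint_analysis hB.le c
      rwa [show (hup.analysis hB.le).adjoint c = 0 from hc] at h
  have hker : T.ker = ⊥ := LinearMap.ker_eq_bot.2 hanti.injective
  exact ⟨A, ContinuousLinearEquiv.ofBijective T hker hrange, hA, fun _ _ => rfl, hle,
    hup.hasSum_adjoint_analysis hB.le⟩

end AnalysisOperator

/-- If a Riesz basis `(gₙ)` of a separable Hilbert space is dextrodual to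
`(xₙ)`, then `∑ₙ cₙ xₙ` converges for every `(cₙ) ∈ ℓ²`, the synthesis operator of
`(xₙ)` is bounded, and every `f` satisfies `f = ∑ₙ ⟨f, xₙ⟩ gₙ`. -/
theorem statement19 {H : Type*} [NormedAddCommGroup H] [InnerProductSpace ℂ H]
    [CompleteSpace H] [TopologicalSpace.SeparableSpace H]
    (g x : ℕ → H) (hg : IsRieszBasis g) (hdex : IsDextrodual g x) :
    (∀ c : ℕ → ℂ, (Summable fun n => ‖c n‖ ^ 2) →
      ∃ s : H, Tendsto (fun N => ∑ n ∈ Finset.range N, c n • x n) atTop (nhds s)) ∧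
    (∃ C : ℝ, 0 < C ∧ ∀ c : ℕ → ℂ, (Summable fun n => ‖c n‖ ^ 2) → ∀ s : H,
      Tendsto (fun N => ∑ n ∈ Finset.range N, c n • x n) atTop (nhds s) →
        ‖s‖ ^ 2 ≤ C * ∑' n, ‖c n‖ ^ 2) ∧
    (∀ f : H, Tendsto (fun N => ∑ n ∈ Finset.range N, ⟪x n, f⟫ • g n) atTop (nhds f)) := by
  obtain ⟨A, T, hA, hT, hlow, hsyn⟩ := hg.exists_analysis_equiv
  have hlim (c : lp (fun _ : ℕ => ℂ) 2) :
      Tendsto (fun N => ∑ n ∈ Finset.range N, c n • x n) atTop (nhds (T.symm c)) := by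
    simpa only [← hT, T.apply_symm_apply] using hdex (T.symm c)
  have hlift (c : ℕ → ℂ) (hc : Summable fun n => ‖c n‖ ^ 2) :
      Tendsto (fun N => ∑ n ∈ Finset.range N, c n • x n) atTop
        (nhds (T.symm ⟨c, memℓp_two_of_summable hc⟩)) :=
    hlim ⟨c, memℓp_two_of_summable hc⟩
  have hsingle (k : ℕ) : T.symm (lp.single 2 k 1) = x k := by
    refine tendsto_nhds_unique (hlim _) (tendsto_const_nhds.congr' ?_)
    filter_upwards [eventually_gt_atTop k] with N hN
    rw [Finset.sum_eq_single_of_mem k (Finset.mem_range.2 hN)]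
    · simp
    · intro n _ hn
      simp [hn]
  refine ⟨fun c hc => ⟨_, hlift c hc⟩, ⟨A⁻¹, inv_pos.2 hA, fun c hc s hs => ?_⟩, fun f => ?_⟩
  · rw [tendsto_nhds_unique hs (hlift c hc), inv_mul_eq_div, le_div_iff₀ hA, mul_comm]
    have h := hlow (T.symm ⟨c, memℓp_two_of_summable hc⟩)
    rwa [T.apply_symm_apply, lp_two_norm_sq] at h
  · let S : lp (fun _ : ℕ => ℂ) 2 →L[ℂ] H := T.symm
    have hcoeff (n : ℕ) : S.adjoint f n = ⟪x n, f⟫ := by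
      have h := lp.inner_single_left (𝕜 := ℂ) n (1 : ℂ) (S.adjoint f)
      rw [ContinuousLinearMap.adjoint_inner_right] at h
      simpa [S, hsingle] using h.symm
    have hid : (T : H →L[ℂ] lp (fun _ : ℕ => ℂ) 2).adjoint (S.adjoint f) = f := by
      refine ext_inner_right ℂ fun y => ?_
      simp [S, ContinuousLinearMap.adjoint_inner_left]
    have h := (hsyn (S.adjoint f)).tendsto_sum_nat
    simpa only [hid, hcoeff] using h

end
end
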